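/- arXiv:2309.12703 — 3 statements merged into one kernel-verified Lean document; each statement's English description precedes it below -/
import Mathlib

section
/- Let l ≥ 2 and 1 ≤ i ≤ l−1. The number of distinct sets S₊(λ), as λ ranges over the admissible linear functionals on ℝ^l (type B_l data) with S₋(λ) = {e_1 − e_j : 2 ≤ j ≤ i+1}, equals l − i + 1. -/
noncomputable section

/-- The `i`-th standard basis vector of `ℝ^l`. -/
def stdVec (l : ℕ) (i : Fin l) : Fin l → ℝ := Pi.single i 1

/-- Compact positive roots of `SO₀(2, 2l-1)` (type `B_l`):
`{eᵢ − eⱼ, eᵢ + eⱼ : 2 ≤ i < j ≤ l} ∪ {eᵢ : 2 ≤ i ≤ l}` (1-indexed in the paper;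
here indices are 0-indexed, so the condition `2 ≤ i` becomes `0 < i`). -/
def DeltaKplusB (l : ℕ) : Set (Fin l → ℝ) :=
  {v | ∃ i j : Fin l, 0 < (i : ℕ) ∧ i < j ∧
      (v = stdVec l i - stdVec l j ∨ v = stdVec l i + stdVec l j)} ∪
  {v | ∃ i : Fin l, 0 < (i : ℕ) ∧ v = stdVec l i}

/-- Noncompact positive roots of `SO₀(2, 2l-1)` (type `B_l`):
`{e₁ − eⱼ : 2 ≤ j ≤ l} ∪ {e₁} ∪ {e₁ + eⱼ : 2 ≤ j ≤ l}` (1-indexed; here 0-indexed). -/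
def DeltaNplusB (l : ℕ) [NeZero l] : Set (Fin l → ℝ) :=
  {v | ∃ j : Fin l, 0 < (j : ℕ) ∧
      (v = stdVec l 0 - stdVec l j ∨ v = stdVec l 0 + stdVec l j)} ∪
  {stdVec l 0}

/-- A linear functional `λ` is admissible if `λ(α) ≥ 0` for all compact positive roots `α`. -/
def AdmissibleB (l : ℕ) (lam : (Fin l → ℝ) →ₗ[ℝ] ℝ) : Prop :=
  ∀ a ∈ DeltaKplusB l, 0 ≤ lam a

/-- `S₊(λ) = {β ∈ Δₙ⁺ : λ(β) > 0}`. -/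
def SplusB (l : ℕ) [NeZero l] (lam : (Fin l → ℝ) →ₗ[ℝ] ℝ) : Set (Fin l → ℝ) :=
  {b | b ∈ DeltaNplusB l ∧ 0 < lam b}

/-- `S₋(λ) = {β ∈ Δₙ⁺ : λ(β) < 0}`. -/
def SminusB (l : ℕ) [NeZero l] (lam : (Fin l → ℝ) →ₗ[ℝ] ℝ) : Set (Fin l → ℝ) :=
  {b | b ∈ DeltaNplusB l ∧ lam b < 0}

section

variable {l : ℕ}

theorem stdVec_inj {j k : Fin l} : stdVec l j = stdVec l k ↔ j = k := by
  refine ⟨fun h => ?_, fun h => h ▸ rfl⟩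
  by_contra hne
  simpa [stdVec, hne] using congrFun h j

theorem stdVec_ne_zero (j : Fin l) : stdVec l j ≠ 0 := fun h => by
  simpa [stdVec] using congrFun h j

theorem add_stdVec_ne_sub_stdVec (v : Fin l → ℝ) (j k : Fin l) :
    v + stdVec l j ≠ v - stdVec l k := fun h => by
  have h1 := congrFun h j
  have h2 : (0 : ℝ) ≤ stdVec l k j := by
    by_cases hjk : j = k <;> simp [stdVec, hjk]
  have h3 : stdVec l j j = 1 := by simp [stdVec]
  simp only [Pi.add_apply, Pi.sub_apply] at h1
  linarith

theorem exists_linearMap_stdVec (c : Fin l → ℝ) :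
    ∃ lam : (Fin l → ℝ) →ₗ[ℝ] ℝ, ∀ j, lam (stdVec l j) = c j :=
  ⟨(Pi.basisFun ℝ (Fin l)).constr ℝ c, fun j => by
    simpa [stdVec] using (Pi.basisFun ℝ (Fin l)).constr_basis ℝ c j⟩

/-- Admissibility in coordinates: the coordinates after the first one are nonnegative and
weakly decreasing. -/
theorem admissibleB_iff (lam : (Fin l → ℝ) →ₗ[ℝ] ℝ) :
    AdmissibleB l lam ↔ (∀ j : Fin l, 0 < (j : ℕ) → 0 ≤ lam (stdVec l j)) ∧
      ∀ j k : Fin l, 0 < (j : ℕ) → j ≤ k → lam (stdVec l k) ≤ lam (stdVec l j) := by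
  constructor
  · intro h
    refine ⟨fun j hj => h _ (Or.inr ⟨j, hj, rfl⟩), fun j k hj hjk => ?_⟩
    rcases hjk.eq_or_lt with rfl | hlt
    · exact le_rfl
    · have := h _ (Or.inl ⟨j, k, hj, hlt, Or.inl rfl⟩)
      rw [map_sub] at this
      linarith
  · rintro ⟨h0, h1⟩ v (⟨j, k, hj, hjk, rfl | rfl⟩ | ⟨j, hj, rfl⟩)
    · rw [map_sub]
      linarith [h1 j k hj hjk.le]
    · rw [map_add]
      have hk : 0 < (k : ℕ) := hj.trans hjk
      linarith [h0 j hj, h0 k hk]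
    · exact h0 j hj

theorem sminusB_eq_chain_iff [NeZero l] {lam : (Fin l → ℝ) →ₗ[ℝ] ℝ} (i : ℕ)
    (hadm : AdmissibleB l lam) :
    SminusB l lam =
        {v | ∃ j : Fin l, 1 ≤ (j : ℕ) ∧ (j : ℕ) ≤ i ∧ v = stdVec l 0 - stdVec l j} ↔
      0 ≤ lam (stdVec l 0) ∧ ∀ j : Fin l, 0 < (j : ℕ) →
        (lam (stdVec l 0) < lam (stdVec l j) ↔ (j : ℕ) ≤ i) := by
  obtain ⟨hpos, -⟩ := (admissibleB_iff lam).1 hadm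
  constructor
  · intro h
    have h0 : 0 ≤ lam (stdVec l 0) := by
      by_contra hneg
      have hmem : stdVec l 0 ∈ SminusB l lam := ⟨Or.inr rfl, not_le.1 hneg⟩
      rw [h] at hmem
      obtain ⟨j, -, -, hj⟩ := hmem
      exact stdVec_ne_zero j (sub_eq_self.1 hj.symm)
    refine ⟨h0, fun j hj => ⟨fun hlt => ?_, fun hji => ?_⟩⟩
    · have hmem : stdVec l 0 - stdVec l j ∈ SminusB l lam :=
        ⟨Or.inl ⟨j, hj, Or.inl rfl⟩, by rw [map_sub]; linarith⟩
      rw [h] at hmem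
      obtain ⟨k, -, hk, hjk⟩ := hmem
      rwa [stdVec_inj.1 (sub_right_injective hjk)]
    · have hmem : stdVec l 0 - stdVec l j ∈ SminusB l lam := by
        rw [h]
        exact ⟨j, hj, hji, rfl⟩
      have := hmem.2
      rw [map_sub] at this
      linarith
  · rintro ⟨h0, hiff⟩
    ext v
    constructor
    · rintro ⟨⟨j, hj, rfl | rfl⟩ | rfl, hv⟩
      · rw [map_sub] at hv
        exact ⟨j, hj, (hiff j hj).1 (by linarith), rfl⟩
      · rw [map_add] at hv
        linarith [hpos j hj]
      · linarith
    · rintro ⟨j, hj, hji, rfl⟩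
      have := (hiff j hj).2 hji
      exact ⟨Or.inl ⟨j, hj, Or.inl rfl⟩, by rw [map_sub]; linarith⟩

/-- The roots `e₀ + eⱼ` with `1 ≤ j ≤ i`: the set `S₊(λ)` when `λ(e₀) = 0`. -/
def lowSplusB (l : ℕ) [NeZero l] (i : ℕ) : Set (Fin l → ℝ) :=
  {v | ∃ j : Fin l, 0 < (j : ℕ) ∧ (j : ℕ) ≤ i ∧ v = stdVec l 0 + stdVec l j}

/-- The noncompact positive roots other than the `e₀ - eⱼ` with `j < k`: the sets `S₊(λ)`
when `λ(e₀) > 0`. -/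
def highSplusB (l : ℕ) [NeZero l] (k : ℕ) : Set (Fin l → ℝ) :=
  {v | ∃ j : Fin l, 0 < (j : ℕ) ∧
      ((k ≤ (j : ℕ) ∧ v = stdVec l 0 - stdVec l j) ∨ v = stdVec l 0 + stdVec l j)} ∪
  {stdVec l 0}

theorem stdVec_zero_notMem_lowSplusB [NeZero l] (i : ℕ) : stdVec l 0 ∉ lowSplusB l i := by
  rintro ⟨j, -, -, hj⟩
  exact stdVec_ne_zero j (left_eq_add.1 hj)

theorem sub_mem_highSplusB_iff [NeZero l] (k : ℕ) (j : Fin l) (hj : 0 < (j : ℕ)) :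
    stdVec l 0 - stdVec l j ∈ highSplusB l k ↔ k ≤ (j : ℕ) := by
  constructor
  · rintro (⟨m, -, ⟨hm, h⟩ | h⟩ | h)
    · rwa [stdVec_inj.1 (sub_right_injective h)]
    · exact absurd h.symm (add_stdVec_ne_sub_stdVec _ _ _)
    · exact absurd (sub_eq_self.1 h) (stdVec_ne_zero j)
  · exact fun h => Or.inl ⟨j, hj, Or.inl ⟨h, rfl⟩⟩

theorem highSplusB_injOn [NeZero l] {i : ℕ} :
    Set.InjOn (highSplusB l) (Set.Icc (i + 1) l) := by
  have key : ∀ k ∈ Set.Icc (i + 1) l, ∀ m ∈ Set.Icc (i + 1) l,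
      highSplusB l k = highSplusB l m → m ≤ k := by
    intro k hk m hm h
    by_contra! hlt
    have hkl : k < l := hlt.trans_le hm.2
    have hk0 : 0 < k := (Nat.succ_pos i).trans_le hk.1
    have hmem := (sub_mem_highSplusB_iff k ⟨k, hkl⟩ hk0).2 le_rfl
    rw [h, sub_mem_highSplusB_iff _ _ hk0] at hmem
    exact hlt.not_ge hmem
  exact fun k hk m hm h => le_antisymm (key m hm k hk h.symm) (key k hk m hm h)

theorem splusB_eq_lowSplusB [NeZero l] {lam : (Fin l → ℝ) →ₗ[ℝ] ℝ} {i : ℕ}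
    (hadm : AdmissibleB l lam) (h0 : lam (stdVec l 0) = 0)
    (hiff : ∀ j : Fin l, 0 < (j : ℕ) →
      (lam (stdVec l 0) < lam (stdVec l j) ↔ (j : ℕ) ≤ i)) :
    SplusB l lam = lowSplusB l i := by
  obtain ⟨hpos, -⟩ := (admissibleB_iff lam).1 hadm
  ext v
  constructor
  · rintro ⟨⟨j, hj, rfl | rfl⟩ | rfl, hv⟩
    · rw [map_sub] at hv
      linarith [hpos j hj]
    · rw [map_add] at hv
      exact ⟨j, hj, (hiff j hj).1 (by linarith), rfl⟩
    · linarith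
  · rintro ⟨j, hj, hji, rfl⟩
    have := (hiff j hj).2 hji
    exact ⟨Or.inl ⟨j, hj, Or.inr rfl⟩, by rw [map_add]; linarith⟩

theorem splusB_eq_highSplusB [NeZero l] {lam : (Fin l → ℝ) →ₗ[ℝ] ℝ} {k : ℕ}
    (hadm : AdmissibleB l lam) (h0 : 0 < lam (stdVec l 0))
    (hiff : ∀ j : Fin l, 0 < (j : ℕ) →
      (lam (stdVec l j) < lam (stdVec l 0) ↔ k ≤ (j : ℕ))) :
    SplusB l lam = highSplusB l k := by
  obtain ⟨hpos, -⟩ := (admissibleB_iff lam).1 hadm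
  ext v
  constructor
  · rintro ⟨⟨j, hj, rfl | rfl⟩ | rfl, hv⟩
    · rw [map_sub] at hv
      exact Or.inl ⟨j, hj, Or.inl ⟨(hiff j hj).1 (by linarith), rfl⟩⟩
    · exact Or.inl ⟨j, hj, Or.inr rfl⟩
    · exact Or.inr rfl
  · rintro (⟨j, hj, ⟨hk, rfl⟩ | rfl⟩ | rfl)
    · have := (hiff j hj).2 hk
      exact ⟨Or.inl ⟨j, hj, Or.inl rfl⟩, by rw [map_sub]; linarith⟩
    · exact ⟨Or.inl ⟨j, hj, Or.inr rfl⟩, by rw [map_add]; linarith [hpos j hj]⟩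
    · exact ⟨Or.inr rfl, h0⟩

theorem exists_threshold_of_admissibleB [NeZero l] {lam : (Fin l → ℝ) →ₗ[ℝ] ℝ} {i : ℕ}
    (hi : i + 1 ≤ l) (hadm : AdmissibleB l lam)
    (hiff : ∀ j : Fin l, 0 < (j : ℕ) →
      (lam (stdVec l 0) < lam (stdVec l j) ↔ (j : ℕ) ≤ i)) :
    ∃ k ∈ Set.Icc (i + 1) l, ∀ j : Fin l, 0 < (j : ℕ) →
      (lam (stdVec l j) < lam (stdVec l 0) ↔ k ≤ (j : ℕ)) := by
  classical
  obtain ⟨-, hanti⟩ := (admissibleB_iff lam).1 hadm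
  have hex : ∃ n, i + 1 ≤ n ∧ ∀ h : n < l, lam (stdVec l ⟨n, h⟩) < lam (stdVec l 0) :=
    ⟨l, hi, fun h => absurd h (lt_irrefl l)⟩
  obtain ⟨hk1, hk2⟩ := Nat.find_spec hex
  refine ⟨Nat.find hex, ⟨hk1, Nat.find_min' hex ⟨hi, fun h => absurd h (lt_irrefl l)⟩⟩,
    fun j hj => ⟨fun hlt => Nat.find_min' hex ⟨?_, fun _ => hlt⟩, fun hkj => ?_⟩⟩
  · by_contra! hji
    exact hlt.not_gt ((hiff j hj).2 (Nat.lt_succ_iff.1 hji))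
  · exact (hanti ⟨_, hkj.trans_lt j.2⟩ j ((Nat.succ_pos i).trans_le hk1) hkj).trans_lt
      (hk2 (hkj.trans_lt j.2))

theorem exists_splusB_eq_lowSplusB [NeZero l] (i : ℕ) :
    ∃ lam : (Fin l → ℝ) →ₗ[ℝ] ℝ, AdmissibleB l lam ∧
      SminusB l lam =
        {v | ∃ j : Fin l, 1 ≤ (j : ℕ) ∧ (j : ℕ) ≤ i ∧ v = stdVec l 0 - stdVec l j} ∧
      lowSplusB l i = SplusB l lam := by
  obtain ⟨lam, hlam⟩ := exists_linearMap_stdVec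
    (fun j : Fin l => if (j : ℕ) = 0 then 0 else if (j : ℕ) ≤ i then 1 else 0)
  have h0 : lam (stdVec l 0) = 0 := by simp [hlam]
  have hadm : AdmissibleB l lam := by
    refine (admissibleB_iff lam).2 ⟨fun j hj => ?_, fun j k hj hjk => ?_⟩
    · rw [hlam]
      split_ifs <;> norm_num
    · rw [Fin.le_def] at hjk
      simp only [hlam]
      split_ifs <;> first | omega | norm_num
  have hiff : ∀ j : Fin l, 0 < (j : ℕ) →
      (lam (stdVec l 0) < lam (stdVec l j) ↔ (j : ℕ) ≤ i) := by
    intro j hj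
    rw [h0, hlam, if_neg hj.ne']
    split_ifs with h <;> simp [h]
  exact ⟨lam, hadm, (sminusB_eq_chain_iff i hadm).2 ⟨h0.ge, hiff⟩,
    (splusB_eq_lowSplusB hadm h0 hiff).symm⟩

theorem exists_splusB_eq_highSplusB [NeZero l] {i k : ℕ} (hk : i + 1 ≤ k) :
    ∃ lam : (Fin l → ℝ) →ₗ[ℝ] ℝ, AdmissibleB l lam ∧
      SminusB l lam =
        {v | ∃ j : Fin l, 1 ≤ (j : ℕ) ∧ (j : ℕ) ≤ i ∧ v = stdVec l 0 - stdVec l j} ∧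
      highSplusB l k = SplusB l lam := by
  obtain ⟨lam, hlam⟩ := exists_linearMap_stdVec
    (fun j : Fin l => if (j : ℕ) = 0 then 2 else if (j : ℕ) ≤ i then 3 else
      if (j : ℕ) < k then 2 else 1)
  have h0 : lam (stdVec l 0) = 2 := by simp [hlam]
  have hadm : AdmissibleB l lam := by
    refine (admissibleB_iff lam).2 ⟨fun j hj => ?_, fun j m hj hjm => ?_⟩
    · rw [hlam]
      split_ifs <;> norm_num
    · rw [Fin.le_def] at hjm
      simp only [hlam]
      split_ifs <;> first | omega | norm_num
  refine ⟨lam, hadm, (sminusB_eq_chain_iff i hadm).2 ⟨by rw [h0]; norm_num, fun j hj => ?_⟩,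
    (splusB_eq_highSplusB hadm (by rw [h0]; norm_num) fun j hj => ?_).symm⟩
  · rw [h0, hlam, if_neg hj.ne']
    split_ifs with h <;> norm_num [h]
  · rw [h0, hlam, if_neg hj.ne']
    split_ifs with h h' <;> norm_num <;> omega

end


/-- let `l ≥ 2` and `1 ≤ i ≤ l−1`.  The number of distinct sets `S₊(λ)`,
as `λ` ranges over the admissible linear functionals on `ℝ^l` (type `B_l` data) with
`S₋(λ) = {e₁ − eⱼ : 2 ≤ j ≤ i+1}` (1-indexed; 0-indexed: `1 ≤ j ≤ i`),
equals `l − i + 1`. -/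
theorem count_Splus_Sminus_chain_B (l : ℕ) [NeZero l] (hl : 2 ≤ l)
    (i : ℕ) (hi1 : 1 ≤ i) (hi2 : i ≤ l - 1) :
    Set.ncard {S : Set (Fin l → ℝ) |
        ∃ lam : (Fin l → ℝ) →ₗ[ℝ] ℝ, AdmissibleB l lam ∧
          SminusB l lam =
            {v | ∃ j : Fin l, 1 ≤ (j : ℕ) ∧ (j : ℕ) ≤ i ∧ v = stdVec l 0 - stdVec l j} ∧
          S = SplusB l lam} = l - i + 1 := by
  have hset : {S : Set (Fin l → ℝ) |
        ∃ lam : (Fin l → ℝ) →ₗ[ℝ] ℝ, AdmissibleB l lam ∧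
          SminusB l lam =
            {v | ∃ j : Fin l, 1 ≤ (j : ℕ) ∧ (j : ℕ) ≤ i ∧ v = stdVec l 0 - stdVec l j} ∧
          S = SplusB l lam} =
      insert (lowSplusB l i) (highSplusB l '' Set.Icc (i + 1) l) := by
    ext S
    constructor
    · rintro ⟨lam, hadm, hminus, rfl⟩
      obtain ⟨h0, hiff⟩ := (sminusB_eq_chain_iff i hadm).1 hminus
      rcases h0.eq_or_lt with h0 | h0
      · exact Or.inl (splusB_eq_lowSplusB hadm h0.symm hiff)
      · obtain ⟨k, hk, hthr⟩ := exists_threshold_of_admissibleB (by omega) hadm hiff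
        exact Or.inr ⟨k, hk, (splusB_eq_highSplusB hadm h0 hthr).symm⟩
    · rintro (rfl | ⟨k, hk, rfl⟩)
      · exact exists_splusB_eq_lowSplusB i
      · exact exists_splusB_eq_highSplusB hk.1
  have hnotMem : lowSplusB l i ∉ highSplusB l '' Set.Icc (i + 1) l := by
    rintro ⟨k, -, hk⟩
    have hmem : stdVec l 0 ∈ highSplusB l k := Or.inr rfl
    exact stdVec_zero_notMem_lowSplusB i (hk ▸ hmem)
  rw [hset, Set.ncard_insert_of_notMem hnotMem ((Set.finite_Icc _ _).image _),
    highSplusB_injOn.ncard_image, Set.ncard_eq_toFinset_card', Set.toFinset_Icc,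
    Nat.card_Icc]
  omega
end
end

section
/- Let l ≥ 2 and 2 ≤ i ≤ l. The number of distinct sets S₊(λ), as λ ranges over the admissible linear functionals on ℝ^l (type B_l data) with S₋(λ) = {e_1 − e_j : 2 ≤ j ≤ l} ∪ {e_1} ∪ {e_1 + e_j : i ≤ j ≤ l}, equals i − 1. -/
noncomputable section

theorem stdVec_injective (l : ℕ) : Function.Injective (stdVec l) := by
  intro a b hab
  by_contra hne
  have := congrFun hab a
  simp [stdVec, hne] at this

/-- The noncompact roots `e₀ + eⱼ` with `1 ≤ j ≤ k` (0-indexed). -/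
def initialPlusRoots (l : ℕ) [NeZero l] (k : ℕ) : Set (Fin l → ℝ) :=
  {v | ∃ j : Fin l, 1 ≤ (j : ℕ) ∧ (j : ℕ) ≤ k ∧ v = stdVec l 0 + stdVec l j}

theorem initialPlusRoots_injOn (l : ℕ) [NeZero l] :
    Set.InjOn (initialPlusRoots l) (Set.Iio l) := by
  have subset_imp_le : ∀ a < l, ∀ b, initialPlusRoots l a ⊆ initialPlusRoots l b → a ≤ b := by
    intro a ha b hab
    rcases Nat.eq_zero_or_pos a with rfl | hpos
    · exact Nat.zero_le _
    · obtain ⟨j, -, hjb, hj⟩ := hab ⟨⟨a, ha⟩, hpos, le_rfl, rfl⟩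
      have h := stdVec_injective l (add_left_cancel hj)
      simpa [← h] using hjb
  intro a ha b hb hab
  exact le_antisymm (subset_imp_le a ha b hab.subset) (subset_imp_le b hb a hab.superset)

theorem AdmissibleB.nonneg {l : ℕ} {lam : (Fin l → ℝ) →ₗ[ℝ] ℝ} (h : AdmissibleB l lam)
    {j : Fin l} (hj : 0 < (j : ℕ)) : 0 ≤ lam (stdVec l j) :=
  h _ (Or.inr ⟨j, hj, rfl⟩)

theorem AdmissibleB.antitone {l : ℕ} {lam : (Fin l → ℝ) →ₗ[ℝ] ℝ} (h : AdmissibleB l lam)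
    {j k : Fin l} (hj : 0 < (j : ℕ)) (hjk : j ≤ k) : lam (stdVec l k) ≤ lam (stdVec l j) := by
  rcases hjk.eq_or_lt with rfl | hlt
  · exact le_rfl
  · have := h _ (Or.inl ⟨j, k, hj, hlt, Or.inl rfl⟩)
    rw [map_sub] at this
    linarith

/-- If `λ` is admissible with `λ(e₀) < 0` and `λ(e₀ + eⱼ) < 0` for `j > m`, then `S₊(λ)` consists
of the `e₀ + eⱼ` with `1 ≤ j ≤ k`, for some `k ≤ m`. -/
theorem AdmissibleB.exists_SplusB_eq {l : ℕ} [NeZero l] {lam : (Fin l → ℝ) →ₗ[ℝ] ℝ}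
    (h : AdmissibleB l lam) (h0 : lam (stdVec l 0) < 0) {m : ℕ}
    (hm : ∀ j : Fin l, m < (j : ℕ) → lam (stdVec l 0 + stdVec l j) < 0) :
    ∃ k ≤ m, SplusB l lam = initialPlusRoots l k := by
  classical
  have hex : ∃ k, ∀ j : Fin l, k < (j : ℕ) → lam (stdVec l 0 + stdVec l j) ≤ 0 :=
    ⟨m, fun j hj => (hm j hj).le⟩
  refine ⟨Nat.find hex, Nat.find_min' hex fun j hj => (hm j hj).le, ?_⟩
  have hspec := Nat.find_spec hex
  ext v
  constructor
  · rintro ⟨⟨j, hj, rfl | rfl⟩ | rfl, hv⟩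
    · have := h.nonneg hj
      rw [map_sub] at hv
      linarith
    · refine ⟨j, hj, ?_, rfl⟩
      by_contra! hlt
      exact (hspec j hlt).not_gt hv
    · exact absurd hv h0.not_gt
  · rintro ⟨j, hj, hjk, rfl⟩
    refine ⟨Or.inl ⟨j, hj, Or.inr rfl⟩, ?_⟩
    have hmin := Nat.find_min hex (m := Nat.find hex - 1) (by omega)
    push Not at hmin
    obtain ⟨p, hp, hpos⟩ := hmin
    have := h.antitone hj (show j ≤ p from Fin.le_def.2 (by omega))
    rw [map_add] at hpos ⊢
    linarith

/-- The functional on `ℝ^l` with value `-2` on `e₀`, and on the remaining `eⱼ` with value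
`3` for `j ≤ k`, `2` for `k < j ≤ m` and `1` otherwise. -/
def stepFunctional (l k m : ℕ) : (Fin l → ℝ) →ₗ[ℝ] ℝ :=
  Fintype.linearCombination ℝ fun j : Fin l =>
    if (j : ℕ) = 0 then (-2 : ℝ) else if (j : ℕ) ≤ k then 3 else if (j : ℕ) ≤ m then 2 else 1

theorem stepFunctional_stdVec (l k m : ℕ) (j : Fin l) :
    stepFunctional l k m (stdVec l j) =
      if (j : ℕ) = 0 then (-2 : ℝ) else if (j : ℕ) ≤ k then 3 else if (j : ℕ) ≤ m then 2 else 1 := by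
  simp [stepFunctional, stdVec]

theorem stepFunctional_stdVec_zero (l k m : ℕ) [NeZero l] :
    stepFunctional l k m (stdVec l 0) = -2 := by
  simp [stepFunctional_stdVec]

theorem stepFunctional_stdVec_pos (l k m : ℕ) {j : Fin l} (hj : 0 < (j : ℕ)) :
    stepFunctional l k m (stdVec l j) =
      if (j : ℕ) ≤ k then 3 else if (j : ℕ) ≤ m then 2 else 1 := by
  rw [stepFunctional_stdVec, if_neg hj.ne']

theorem admissibleB_stepFunctional (l k m : ℕ) : AdmissibleB l (stepFunctional l k m) := by
  rintro a (⟨p, q, hp, hpq, rfl | rfl⟩ | ⟨p, hp, rfl⟩)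
  all_goals
    try have hq : 0 < (q : ℕ) := hp.trans hpq
    try have hpq' : (p : ℕ) < q := hpq
    simp only [map_sub, map_add, stepFunctional_stdVec_pos l k m, *]
    split_ifs <;> first | omega | norm_num

theorem SplusB_stepFunctional (l k m : ℕ) [NeZero l] :
    SplusB l (stepFunctional l k m) = initialPlusRoots l k := by
  ext v
  constructor
  · rintro ⟨⟨j, hj, rfl | rfl⟩ | rfl, hv⟩
    · rw [map_sub, stepFunctional_stdVec_zero, stepFunctional_stdVec_pos l k m hj] at hv
      split_ifs at hv <;> norm_num at hv
    · rw [map_add, stepFunctional_stdVec_zero, stepFunctional_stdVec_pos l k m hj] at hv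
      refine ⟨j, hj, ?_, rfl⟩
      by_contra hjk
      split_ifs at hv <;> norm_num at hv
    · rw [stepFunctional_stdVec_zero] at hv
      norm_num at hv
  · rintro ⟨j, hj, hjk, rfl⟩
    refine ⟨Or.inl ⟨j, hj, Or.inr rfl⟩, ?_⟩
    rw [map_add, stepFunctional_stdVec_zero, stepFunctional_stdVec_pos l k m hj, if_pos hjk]
    norm_num

theorem SminusB_stepFunctional (l : ℕ) [NeZero l] {k i : ℕ} (hi : 2 ≤ i) (hk : k < i - 1) :
    SminusB l (stepFunctional l k (i - 2)) =
      ({v | ∃ j : Fin l, 1 ≤ (j : ℕ) ∧ v = stdVec l 0 - stdVec l j} ∪ {stdVec l 0} ∪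
        {v | ∃ j : Fin l, i - 1 ≤ (j : ℕ) ∧ v = stdVec l 0 + stdVec l j}) := by
  ext v
  constructor
  · rintro ⟨⟨j, hj, rfl | rfl⟩ | rfl, hv⟩
    · exact Or.inl (Or.inl ⟨j, hj, rfl⟩)
    · rw [map_add, stepFunctional_stdVec_zero, stepFunctional_stdVec_pos l k _ hj] at hv
      refine Or.inr ⟨j, ?_, rfl⟩
      by_contra hji
      split_ifs at hv <;> first | omega | norm_num at hv
    · exact Or.inl (Or.inr rfl)
  · rintro ((⟨j, hj, rfl⟩ | rfl) | ⟨j, hj, rfl⟩)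
    · refine ⟨Or.inl ⟨j, hj, Or.inl rfl⟩, ?_⟩
      rw [map_sub, stepFunctional_stdVec_zero, stepFunctional_stdVec_pos l k _ hj]
      split_ifs <;> norm_num
    · refine ⟨Or.inr rfl, ?_⟩
      rw [stepFunctional_stdVec_zero]
      norm_num
    · have hj0 : 0 < (j : ℕ) := by omega
      refine ⟨Or.inl ⟨j, hj0, Or.inr rfl⟩, ?_⟩
      rw [map_add, stepFunctional_stdVec_zero, stepFunctional_stdVec_pos l k _ hj0,
        if_neg (by omega), if_neg (by omega)]
      norm_num

/-- let `l ≥ 2` and `2 ≤ i ≤ l`.  The number of distinct sets `S₊(λ)`, as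
`λ` ranges over the admissible linear functionals on `ℝ^l` (type `B_l` data) with
`S₋(λ) = {e₁ − eⱼ : 2 ≤ j ≤ l} ∪ {e₁} ∪ {e₁ + eⱼ : i ≤ j ≤ l}` (1-indexed;
0-indexed: `{e₀ − eⱼ : 1 ≤ j} ∪ {e₀} ∪ {e₀ + eⱼ : i−1 ≤ j}`), equals `i − 1`. -/
theorem count_Splus_Sminus_large_B (l : ℕ) [NeZero l] (hl : 2 ≤ l)
    (i : ℕ) (hi1 : 2 ≤ i) (hi2 : i ≤ l) :
    Set.ncard {S : Set (Fin l → ℝ) |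
        ∃ lam : (Fin l → ℝ) →ₗ[ℝ] ℝ, AdmissibleB l lam ∧
          SminusB l lam =
            ({v | ∃ j : Fin l, 1 ≤ (j : ℕ) ∧ v = stdVec l 0 - stdVec l j} ∪ {stdVec l 0} ∪
             {v | ∃ j : Fin l, i - 1 ≤ (j : ℕ) ∧ v = stdVec l 0 + stdVec l j}) ∧
          S = SplusB l lam} = i - 1 := by
  have himage : {S : Set (Fin l → ℝ) |
        ∃ lam : (Fin l → ℝ) →ₗ[ℝ] ℝ, AdmissibleB l lam ∧
          SminusB l lam =
            ({v | ∃ j : Fin l, 1 ≤ (j : ℕ) ∧ v = stdVec l 0 - stdVec l j} ∪ {stdVec l 0} ∪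
             {v | ∃ j : Fin l, i - 1 ≤ (j : ℕ) ∧ v = stdVec l 0 + stdVec l j}) ∧
          S = SplusB l lam} = initialPlusRoots l '' Set.Iio (i - 1) := by
    ext S
    constructor
    · rintro ⟨lam, hadm, hminus, rfl⟩
      have h0 : stdVec l 0 ∈ SminusB l lam := hminus ▸ Or.inl (Or.inr rfl)
      obtain ⟨k, hk, hS⟩ := hadm.exists_SplusB_eq h0.2 (m := i - 2) fun j hj => by
        have hj' : stdVec l 0 + stdVec l j ∈ SminusB l lam :=
          hminus ▸ Or.inr ⟨j, by omega, rfl⟩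
        exact hj'.2
      exact ⟨k, Set.mem_Iio.2 (by omega), hS.symm⟩
    · rintro ⟨k, hk, rfl⟩
      exact ⟨stepFunctional l k (i - 2), admissibleB_stepFunctional l k _,
        SminusB_stepFunctional l hi1 hk, (SplusB_stepFunctional l k _).symm⟩
  rw [himage, Set.InjOn.ncard_image
    ((initialPlusRoots_injOn l).mono (Set.Iio_subset_Iio (by omega)))]
  simp [← Finset.coe_Iio, Set.ncard_coe_finset]
end
end

section
/- The number of distinct sets S₊(λ), as λ ranges over the admissible linear functionals on ℝ^l (type D_l data) with S₋(λ) = ∅, equals l + 2. -/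
noncomputable section

/-- Compact positive roots of `SO₀(2, 2l-2)` (type `D_l`):
`{eᵢ − eⱼ, eᵢ + eⱼ : 2 ≤ i < j ≤ l}` (1-indexed in the paper;
here indices are 0-indexed, so the condition `2 ≤ i` becomes `0 < i`). -/
def DeltaKplusD (l : ℕ) : Set (Fin l → ℝ) :=
  {v | ∃ i j : Fin l, 0 < (i : ℕ) ∧ i < j ∧
      (v = stdVec l i - stdVec l j ∨ v = stdVec l i + stdVec l j)}

/-- Noncompact positive roots of `SO₀(2, 2l-2)` (type `D_l`):
`{e₁ − eⱼ : 2 ≤ j ≤ l} ∪ {e₁ + eⱼ : 2 ≤ j ≤ l}` (1-indexed; here 0-indexed). -/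
def DeltaNplusD (l : ℕ) [NeZero l] : Set (Fin l → ℝ) :=
  {v | ∃ j : Fin l, 0 < (j : ℕ) ∧
      (v = stdVec l 0 - stdVec l j ∨ v = stdVec l 0 + stdVec l j)}

/-- A linear functional `λ` is admissible if `λ(α) ≥ 0` for all compact positive roots `α`. -/
def AdmissibleD (l : ℕ) (lam : (Fin l → ℝ) →ₗ[ℝ] ℝ) : Prop :=
  ∀ a ∈ DeltaKplusD l, 0 ≤ lam a

/-- `S₊(λ) = {β ∈ Δₙ⁺ : λ(β) > 0}`. -/
def SplusD (l : ℕ) [NeZero l] (lam : (Fin l → ℝ) →ₗ[ℝ] ℝ) : Set (Fin l → ℝ) :=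
  {b | b ∈ DeltaNplusD l ∧ 0 < lam b}

/-- `S₋(λ) = {β ∈ Δₙ⁺ : λ(β) < 0}`. -/
def SminusD (l : ℕ) [NeZero l] (lam : (Fin l → ℝ) →ₗ[ℝ] ℝ) : Set (Fin l → ℝ) :=
  {b | b ∈ DeltaNplusD l ∧ lam b < 0}

/-- The functional `v ↦ ∑ i, v i * x i` sends the standard basis vector `eᵢ` to `x i`. -/
theorem linearCombination_stdVec {l : ℕ} (x : Fin l → ℝ) (i : Fin l) :
    Fintype.linearCombination ℝ x (stdVec l i) = x i := by
  simp [stdVec]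

theorem admissibleD_iff {l : ℕ} (lam : (Fin l → ℝ) →ₗ[ℝ] ℝ) :
    AdmissibleD l lam ↔ ∀ i j : Fin l, 0 < (i : ℕ) → i < j →
      0 ≤ lam (stdVec l i) - lam (stdVec l j) ∧ 0 ≤ lam (stdVec l i) + lam (stdVec l j) := by
  simp only [← map_sub, ← map_add]
  constructor
  · exact fun h i j hi hij =>
      ⟨h _ ⟨i, j, hi, hij, Or.inl rfl⟩, h _ ⟨i, j, hi, hij, Or.inr rfl⟩⟩
  · rintro h _ ⟨i, j, hi, hij, rfl | rfl⟩
    exacts [(h i j hi hij).1, (h i j hi hij).2]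

theorem sminusD_eq_empty_iff {l : ℕ} [NeZero l] (lam : (Fin l → ℝ) →ₗ[ℝ] ℝ) :
    SminusD l lam = ∅ ↔ ∀ j : Fin l, 0 < (j : ℕ) →
      0 ≤ lam (stdVec l 0) - lam (stdVec l j) ∧ 0 ≤ lam (stdVec l 0) + lam (stdVec l j) := by
  simp only [← map_sub, ← map_add, Set.eq_empty_iff_forall_notMem, SminusD, Set.mem_ofPred_eq,
    not_and, not_lt]
  constructor
  · exact fun h j hj => ⟨h _ ⟨j, hj, Or.inl rfl⟩, h _ ⟨j, hj, Or.inr rfl⟩⟩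
  · rintro h _ ⟨j, hj, rfl | rfl⟩
    exacts [(h j hj).1, (h j hj).2]

theorem splusD_eq_iff {l : ℕ} [NeZero l] (lam mu : (Fin l → ℝ) →ₗ[ℝ] ℝ) :
    SplusD l lam = SplusD l mu ↔ ∀ j : Fin l, 0 < (j : ℕ) →
      (0 < lam (stdVec l 0) - lam (stdVec l j) ↔ 0 < mu (stdVec l 0) - mu (stdVec l j)) ∧
      (0 < lam (stdVec l 0) + lam (stdVec l j) ↔ 0 < mu (stdVec l 0) + mu (stdVec l j)) := by
  simp only [← map_sub, ← map_add, Set.ext_iff, SplusD, Set.mem_ofPred_eq, and_congr_right_iff]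
  constructor
  · exact fun h j hj => ⟨h _ ⟨j, hj, Or.inl rfl⟩, h _ ⟨j, hj, Or.inr rfl⟩⟩
  · rintro h _ ⟨j, hj, rfl | rfl⟩
    exacts [(h j hj).1, (h j hj).2]

/-- Coordinates of representatives of the possible sets `S₊`: the zero functional,
`(1, …, 1, -1)`, and `(1, …, 1, 0, …, 0)` with last `1` in position `m`. -/
def repD (l : ℕ) : Option (Option (Fin l)) → Fin l → ℝ
  | none, _ => 0
  | some none, i => if (i : ℕ) + 1 = l then -1 else 1
  | some (some m), i => if i ≤ m then 1 else 0

theorem admissibleD_repD (l : ℕ) (k : Option (Option (Fin l))) :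
    AdmissibleD l (Fintype.linearCombination ℝ (repD l k)) := by
  simp only [admissibleD_iff, linearCombination_stdVec]
  intro i j _ hij
  rcases k with _ | _ | m <;> simp only [repD]
  · simp
  · have : (i : ℕ) + 1 ≠ l := by omega
    rw [if_neg this]
    split_ifs <;> norm_num
  · by_cases hj : j ≤ m
    · norm_num [hj, hij.le.trans hj]
    · split_ifs <;> norm_num

theorem sminusD_repD {l : ℕ} [NeZero l] (k : Option (Option (Fin l))) :
    SminusD l (Fintype.linearCombination ℝ (repD l k)) = ∅ := by
  simp only [sminusD_eq_empty_iff, linearCombination_stdVec]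
  intro j hj
  rcases k with _ | _ | m <;> simp only [repD, Fin.val_zero, Fin.zero_le, if_true]
  · simp
  · have : 0 + 1 ≠ l := by omega
    simp only [this, if_false]
    split_ifs <;> norm_num
  · split_ifs <;> norm_num

theorem splusD_repD_injective {l : ℕ} [NeZero l] (hl : 2 ≤ l) :
    Function.Injective fun k => SplusD l (Fintype.linearCombination ℝ (repD l k)) := by
  have h0 : 0 + 1 ≠ l := by omega
  have last_pos : 0 < ((⟨l - 1, by omega⟩ : Fin l) : ℕ) := by simp only; omega
  have last_succ : l - 1 + 1 = l := by omega
  intro k k' h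
  simp only [splusD_eq_iff, linearCombination_stdVec] at h
  have h_last := h _ last_pos
  rcases k with _ | _ | m <;> rcases k' with _ | _ | m' <;>
    simp only [repD, Fin.val_zero, Fin.zero_le, if_true, h0, last_succ, if_false] at h h_last
  · rfl
  · norm_num at h_last
  · split_ifs at h_last <;> norm_num at h_last
  · norm_num at h_last
  · rfl
  · split_ifs at h_last <;> norm_num at h_last
  · split_ifs at h_last <;> norm_num at h_last
  · split_ifs at h_last <;> norm_num at h_last
  · rcases lt_trichotomy m m' with hm | rfl | hm
    · have := (h m' (by omega)).1
      simp [hm.not_ge] at this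
    · rfl
    · have := (h m (by omega)).1
      simp [hm.not_ge] at this

theorem exists_splusD_eq_repD {l : ℕ} [NeZero l] (hl : 2 ≤ l) (lam : (Fin l → ℝ) →ₗ[ℝ] ℝ)
    (hadm : AdmissibleD l lam) (hneg : SminusD l lam = ∅) :
    ∃ k, SplusD l (Fintype.linearCombination ℝ (repD l k)) = SplusD l lam := by
  rw [admissibleD_iff] at hadm
  rw [sminusD_eq_empty_iff] at hneg
  simp only [splusD_eq_iff, linearCombination_stdVec]
  generalize hx : (fun i => lam (stdVec l i)) = x
  replace hx : ∀ i, lam (stdVec l i) = x i := fun i => congrFun hx i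
  simp only [hx] at *
  have h0 : 0 + 1 ≠ l := by omega
  have x0_nonneg : 0 ≤ x 0 := by
    have := hneg ⟨1, by omega⟩ one_pos
    linarith
  rcases x0_nonneg.eq_or_lt with hx0 | hx0
  · refine ⟨none, fun j hj => ?_⟩
    have := hneg j hj
    simp only [repD, sub_zero, add_zero, lt_irrefl, false_iff, not_lt]
    constructor <;> linarith
  by_cases hex : ∃ j : Fin l, 0 < (j : ℕ) ∧ x j = -x 0
  · obtain ⟨j, hj, hxj⟩ := hex
    have hj_last : (j : ℕ) + 1 = l := by
      by_contra hne
      have := hadm j ⟨j + 1, by omega⟩ hj (Fin.lt_def.2 (by simp))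
      linarith
    refine ⟨some none, fun i hi => ?_⟩
    simp only [repD, Fin.val_zero, h0, if_false]
    split_ifs with hil
    · obtain rfl : i = j := by omega
      rw [hxj]
      norm_num [hx0]
    · have h1 := hadm i j hi (by omega)
      have h2 := hneg i hi
      have hxi : x i = x 0 := by linarith
      rw [hxi]
      norm_num [hx0]
  · obtain ⟨m, hm, hmax⟩ := Finset.exists_max_image (Finset.univ.filter fun i => x i = x 0) id
      ⟨0, by simp⟩
    simp only [Finset.mem_filter, Finset.mem_univ, true_and, id] at hm hmax
    refine ⟨some (some m), fun j hj => ?_⟩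
    have h2 := hneg j hj
    have hplus : 0 < x 0 + x j :=
      h2.2.lt_of_ne fun h => hex ⟨j, hj, by linarith⟩
    simp only [repD, Fin.zero_le, if_true]
    split_ifs with hjm
    · have hxj : x j = x 0 := by
        rcases hjm.eq_or_lt with rfl | hlt
        · exact hm
        · have := hadm j m hj hlt
          linarith
      rw [hxj]
      norm_num [hx0]
    · have hminus : 0 < x 0 - x j :=
        h2.1.lt_of_ne fun h => hjm (hmax j (by linarith))
      simp [hplus, hminus, -sub_pos]

/-- the number of distinct sets `S₊(λ)`, as `λ` ranges over the admissible
linear functionals on `ℝ^l` (type `D_l` data) with `S₋(λ) = ∅`, equals `l + 2`. -/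
theorem count_Splus_Sminus_empty_D (l : ℕ) [NeZero l] (hl : 2 ≤ l) :
    Set.ncard {S : Set (Fin l → ℝ) |
        ∃ lam : (Fin l → ℝ) →ₗ[ℝ] ℝ, AdmissibleD l lam ∧
          SminusD l lam = ∅ ∧ S = SplusD l lam} = l + 2 := by
  have hset : {S : Set (Fin l → ℝ) | ∃ lam : (Fin l → ℝ) →ₗ[ℝ] ℝ, AdmissibleD l lam ∧
      SminusD l lam = ∅ ∧ S = SplusD l lam} =
      Set.range fun k => SplusD l (Fintype.linearCombination ℝ (repD l k)) := by
    ext S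
    constructor
    · rintro ⟨lam, hadm, hneg, rfl⟩
      exact exists_splusD_eq_repD hl lam hadm hneg
    · rintro ⟨k, rfl⟩
      exact ⟨_, admissibleD_repD l k, sminusD_repD k, rfl⟩
  rw [hset, ← Set.image_univ, Set.ncard_image_of_injective _ (splusD_repD_injective hl),
    Set.ncard_univ, Nat.card_eq_fintype_card]
  simp
end
end
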